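/- Let μ be a complex number and n ≥ 2 an integer. Then b_{2n}(1,1,μ) · b_{2n−1}(0,1,μ) · b_{2n−1}(1,0,μ) = − b_{2n−2}(1,1,μ) · b_{2n}(0,1,μ) · b_{2n}(1,0,μ). (Equivalently, when the denominators are nonzero, b_{2n}(1,1)/b_{2n−2}(1,1) = −( b_{2n}(0,1)/b_{2n−1}(0,1) ) · ( b_{2n}(1,0)/b_{2n−1}(1,0) ).) -/

import Mathlib

/-- Generalized binomial coefficient `C(x,k) = x(x-1)⋯(x-k+1)/k!` for complex `x`. -/
noncomputable def gbinom (x : ℂ) (k : ℕ) : ℂ :=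
  (∏ i ∈ Finset.range k, (x - i)) / (k.factorial : ℂ)

/-- Pochhammer symbol `(x)_k = x(x+1)⋯(x+k-1)`. -/
noncomputable def poch (x : ℂ) (k : ℕ) : ℂ :=
  ∏ i ∈ Finset.range k, (x + i)
/-- `b_n(I,J,μ)`: determinant of the `n×n` matrix with rows indexed by
`i = I,…,n-1+I`, columns indexed by `j = J,…,n-1+J`, and entries
`-δ_{i,j} + C(μ+i+j-2, j)`. -/
noncomputable def bdet (μ : ℂ) (n I J : ℕ) : ℂ :=
  Matrix.det (Matrix.of fun i j : Fin n =>
    (if I + i.1 = J + j.1 then (-1 : ℂ) else 0)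
      + gbinom (μ + ((I + i.1 : ℕ) : ℂ) + ((J + j.1 : ℕ) : ℂ) - 2) (J + j.1))

open Matrix in
/-- Jacobi's complementary minor theorem for a `2 × 2` minor of the adjugate. -/
theorem det_adjugate_toBlocks₁₁_of_regular {R q : Type*} [CommRing R] [IsDomain R] [Fintype q]
    [DecidableEq q] (A : Matrix (Fin 2 ⊕ q) (Fin 2 ⊕ q) R) (hA : A.det ≠ 0) :
    A.adjugate.toBlocks₁₁.det = A.det * A.toBlocks₂₂.det := by
  have hmul : A * fromBlocks A.adjugate.toBlocks₁₁ 0 A.adjugate.toBlocks₂₁ 1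
      = fromBlocks (A.det • 1) A.toBlocks₁₂ 0 A.toBlocks₂₂ := by
    have h := mul_adjugate A
    rw [← fromBlocks_toBlocks A.adjugate] at h
    nth_rw 1 [← fromBlocks_toBlocks A] at h ⊢
    rw [fromBlocks_multiply, ← fromBlocks_one, fromBlocks_smul, fromBlocks_inj] at h
    rw [fromBlocks_multiply, fromBlocks_inj]
    refine ⟨h.1, by simp, by simpa using h.2.2.1, by simp⟩
  have hdet := congrArg det hmul
  rw [det_mul, det_fromBlocks_zero₁₂, det_fromBlocks_zero₂₁, det_smul, det_one, det_one,
    Fintype.card_fin] at hdet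
  apply mul_left_cancel₀ hA
  linear_combination hdet

open Matrix in
theorem det_adjugate_toBlocks₁₁ {R q : Type*} [CommRing R] [Fintype q]
    [DecidableEq q] (A : Matrix (Fin 2 ⊕ q) (Fin 2 ⊕ q) R) :
    A.adjugate.toBlocks₁₁.det = A.det * A.toBlocks₂₂.det := by
  have h := congrArg (MvPolynomial.aeval fun p : (Fin 2 ⊕ q) × (Fin 2 ⊕ q) => A p.1 p.2)
    (det_adjugate_toBlocks₁₁_of_regular (mvPolynomialX (Fin 2 ⊕ q) (Fin 2 ⊕ q) ℤ)
      (det_mvPolynomialX_ne_zero _ ℤ))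
  have hX := mvPolynomialX_mapMatrix_aeval ℤ A
  have hadj : (MvPolynomial.aeval fun p : (Fin 2 ⊕ q) × (Fin 2 ⊕ q) => A p.1 p.2).mapMatrix
      (mvPolynomialX (Fin 2 ⊕ q) (Fin 2 ⊕ q) ℤ).adjugate = A.adjugate := by
    rw [AlgHom.map_adjugate, hX]
  rw [map_mul, AlgHom.map_det, AlgHom.map_det, AlgHom.map_det, hX] at h
  rw [← hadj]
  nth_rw 3 [← hX]
  exact h

/-- Splits off the first and last element of `Fin (m + 2)`. -/
noncomputable def finEndsEquiv (m : ℕ) : Fin 2 ⊕ Fin m ≃ Fin (m + 2) :=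
  Equiv.ofBijective (Sum.elim ![0, Fin.last (m + 1)] fun i => i.castSucc.succ) <| by
    rw [Fintype.bijective_iff_injective_and_card]
    refine ⟨?_, by simp [add_comm]⟩
    rintro (i | i) (j | j) h
    · fin_cases i <;> fin_cases j <;> simp_all [Fin.ext_iff]
    · fin_cases i <;> simp [Fin.ext_iff] at h
      omega
    · fin_cases j <;> simp [Fin.ext_iff] at h
      omega
    · simpa [Fin.ext_iff] using h

open Matrix in
/-- The Desnanot–Jacobi identity (Dodgson condensation). -/
theorem desnanot_jacobi {R : Type*} [CommRing R] {m : ℕ}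
    (A : Matrix (Fin (m + 2)) (Fin (m + 2)) R) :
    (A.submatrix Fin.succ Fin.succ).det * (A.submatrix Fin.castSucc Fin.castSucc).det
      - (A.submatrix Fin.castSucc Fin.succ).det * (A.submatrix Fin.succ Fin.castSucc).det
      = A.det * (A.submatrix (fun i : Fin m => i.castSucc.succ) fun i => i.castSucc.succ).det := by
  have h := det_adjugate_toBlocks₁₁ (A.submatrix (finEndsEquiv m) (finEndsEquiv m))
  rw [adjugate_submatrix_equiv_self, det_submatrix_equiv_self, det_fin_two] at h
  have h0 : finEndsEquiv m (Sum.inl 0) = 0 := rfl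
  have h1 : finEndsEquiv m (Sum.inl 1) = Fin.last (m + 1) := rfl
  simp only [toBlocks₁₁, of_apply, submatrix_apply, h0, h1, adjugate_fin_succ_eq_det_submatrix,
    Fin.succAbove_last] at h
  have hs : (Fin.succAbove (0 : Fin (m + 2))) = Fin.succ := by
    ext i; simp
  rw [hs] at h
  have hsq : ((-1 : R) ^ (m + 1)) * (-1) ^ (m + 1) = 1 := by
    rw [← mul_pow]; simp
  have hsq2 : ((-1 : R) ^ (m + 1 + (m + 1))) = 1 := by
    rw [pow_add, hsq]
  simp only [Fin.val_zero, Fin.val_last, add_zero, zero_add, pow_zero, one_mul, hsq2] at h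
  have hc : A.det * (A.submatrix (fun i : Fin m => i.castSucc.succ)
      fun i => i.castSucc.succ).det = _ := h.symm
  rw [hc]
  linear_combination ((A.submatrix Fin.castSucc Fin.succ).det *
    (A.submatrix Fin.succ Fin.castSucc).det) * hsq

open Matrix in
/-- If `A` and `B` are involutions with equal determinants in odd
dimension, then `A * B - 1` is singular. -/
theorem det_sub_eq_zero_of_involutions {K : Type*} [Field K] [CharZero K] {n : ℕ} (hn : Odd n)
    (A B : Matrix (Fin n) (Fin n) K) (hA : A * A = 1) (hB : B * B = 1) (hd : A.det = B.det) :
    (A * B - 1).det = 0 := by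
  have h1 : A * B - 1 = A * (B - A) := by rw [mul_sub, hA]
  have h2 : A * B - 1 = (A - B) * B := by rw [sub_mul, hB]
  have h3 : (B - A).det = -(A - B).det := by
    rw [← neg_sub A B, det_neg, Fintype.card_fin, hn.neg_one_pow, neg_one_mul]
  have h4 := congrArg det h1
  rw [h2, det_mul, det_mul, h3, hd] at h4
  rw [h2, det_mul]
  have h5 : (2 : K) * ((A - B).det * B.det) = 0 := by linear_combination h4
  simpa using h5

theorem gbinom_eq_choose (x : ℂ) (k : ℕ) : gbinom x k = Ring.choose x k := by
  have h : (descPochhammer ℤ k).smeval x = ∏ i ∈ Finset.range k, (x - i) := by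
    rw [← descPochhammer_eval_eq_prod_range, ← descPochhammer_map (Int.castRingHom ℂ),
      Polynomial.eval_map, ← Polynomial.aeval_eq_smeval, Polynomial.aeval_def]
    rfl
  rw [Ring.choose_eq_smul, gbinom, h, smul_eq_mul, div_eq_inv_mul]

open Matrix in
/-- The unit upper triangular matrix with entries `C(a + j, j - k)`. -/
noncomputable def binomUpper (a : ℂ) (n : ℕ) : Matrix (Fin n) (Fin n) ℂ :=
  of fun k j => if k ≤ j then Ring.choose (a + (j : ℕ)) ((j : ℕ) - k) else 0

/-- The diagonal matrix of alternating signs. -/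
def signDiag (n : ℕ) : Matrix (Fin n) (Fin n) ℂ :=
  Matrix.diagonal fun i => (-1) ^ (i : ℕ)

open Finset in
theorem sum_choose_mul_choose_alternating (a : ℂ) {i j : ℕ} (hij : i < j) :
    ∑ k ∈ Icc i j,
      (-1 : ℂ) ^ k * (Ring.choose (a + k) (k - i) * Ring.choose (a + j) (j - k)) = 0 := by
  have h1 : ∀ k ∈ Icc i j,
      (-1 : ℂ) ^ k * (Ring.choose (a + k) (k - i) * Ring.choose (a + j) (j - k))
      = (-1) ^ k * ((j - i).choose (j - k) : ℂ) * Ring.choose (a + j) (j - i) := by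
    intro k hk
    rw [mem_Icc] at hk
    have h := Ring.choose_smul_choose (a + j : ℂ) (n := j - i) (k := j - k) (by omega)
    rw [nsmul_eq_mul, show j - i - (j - k) = k - i by omega, Nat.cast_sub hk.2] at h
    rw [show a + j - ((j : ℂ) - k) = a + k by ring] at h
    rw [mul_assoc, h]
    ring
  rw [sum_congr rfl h1, ← sum_mul]
  suffices h : ∑ k ∈ Icc i j, (-1 : ℂ) ^ k * ((j - i).choose (j - k) : ℂ) = 0 by rw [h, zero_mul]
  have h2 : ∑ t ∈ range (j - i + 1), (-1 : ℂ) ^ t * ((j - i).choose t : ℂ) = 0 := by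
    exact_mod_cast Int.alternating_sum_range_choose_of_ne (show j - i ≠ 0 by omega)
  have h3 : ∑ k ∈ Icc i j, (-1 : ℂ) ^ k * ((j - i).choose (j - k) : ℂ)
      = (-1) ^ i * ∑ t ∈ range (j - i + 1), (-1 : ℂ) ^ t * ((j - i).choose t : ℂ) := by
    rw [mul_sum]
    refine sum_bij' (fun k _ => k - i) (fun t _ => t + i) ?_ ?_ ?_ ?_ ?_
    · intro k hk; simp at *; omega
    · intro k hk; simp at *; omega
    · intro k hk; simp at *; omega
    · intro k hk; simp at *
    · intro k hk
      rw [mem_Icc] at hk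
      rw [← mul_assoc, ← pow_add, show i + (k - i) = k by omega,
        ← Nat.choose_symm (show j - k ≤ j - i by omega), show j - i - (j - k) = k - i by omega]
  rw [h3, h2, mul_zero]

open Finset Matrix in
theorem signDiag_mul_binomUpper_sq (a : ℂ) (n : ℕ) :
    (signDiag n * binomUpper a n) * (signDiag n * binomUpper a n) = 1 := by
  ext i j
  rw [mul_apply]
  simp only [signDiag, diagonal_mul, binomUpper, of_apply]
  rcases lt_trichotomy i j with hij | rfl | hij
  · rw [one_apply_ne hij.ne]
    have hsub : Icc (i : ℕ) j ⊆ range n := fun k hk => by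
      simp only [mem_Icc, mem_range] at *; omega
    have hsum : ∀ k : Fin n,
        ((-1 : ℂ) ^ (i : ℕ) * if i ≤ k then Ring.choose (a + (k : ℕ)) ((k : ℕ) - i) else 0)
          * ((-1) ^ (k : ℕ) * if k ≤ j then Ring.choose (a + (j : ℕ)) ((j : ℕ) - k) else 0)
        = (-1) ^ (i : ℕ) * if (k : ℕ) ∈ Icc (i : ℕ) j then (-1 : ℂ) ^ (k : ℕ)
          * (Ring.choose (a + (k : ℕ)) ((k : ℕ) - i) * Ring.choose (a + (j : ℕ)) ((j : ℕ) - k))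
          else 0 := by
      intro k
      simp only [mem_Icc, Fin.le_def]
      by_cases h1 : (i : ℕ) ≤ k <;> by_cases h2 : (k : ℕ) ≤ j <;> simp [h1, h2]
      ring
    rw [sum_congr rfl fun k _ => hsum k, ← mul_sum, Fin.sum_univ_eq_sum_range (fun k =>
      if k ∈ Icc (i : ℕ) j then (-1 : ℂ) ^ k
        * (Ring.choose (a + k) (k - i) * Ring.choose (a + (j : ℕ)) ((j : ℕ) - k)) else 0),
      sum_ite_mem, inter_eq_right.mpr hsub,
      sum_choose_mul_choose_alternating a (Fin.lt_def.mp hij), mul_zero]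
  · rw [sum_eq_single i]
    · simp [← mul_pow]
    · intro k _ hk
      rcases lt_or_gt_of_ne hk with h | h
      · simp [not_le.mpr h]
      · simp [not_le.mpr h]
    · simp
  · rw [one_apply_ne hij.ne']
    refine sum_eq_zero fun k _ => ?_
    by_cases h : i ≤ k
    · simp [not_le.mpr (hij.trans_le h)]
    · simp [h]

open Matrix in
theorem det_binomUpper (a : ℂ) (n : ℕ) : (binomUpper a n).det = 1 := by
  rw [det_of_isUpperTriangular]
  · simp [binomUpper]
  · intro i j hij
    simp [binomUpper, not_le.mpr (show j < i from hij)]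

open Finset Matrix in
theorem binom_matrix_factorization (a : ℂ) (n : ℕ) (i j : Fin n) :
    ((binomUpper 0 n)ᵀ * binomUpper a n) i j = Ring.choose (a + (i : ℕ) + (j : ℕ)) (j : ℕ) := by
  rw [show a + ((i : ℕ) : ℂ) + ((j : ℕ) : ℂ) = ((i : ℕ) : ℂ) + (a + ((j : ℕ) : ℂ)) by ring,
    Ring.add_choose_eq _ (Commute.all _ _), Nat.sum_antidiagonal_eq_sum_range_succ
      (fun p q => Ring.choose ((i : ℕ) : ℂ) p * Ring.choose (a + ((j : ℕ) : ℂ)) q), mul_apply]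
  have hsub : range ((j : ℕ) + 1) ⊆ range n := range_subset_range.mpr j.isLt
  have hsum : ∀ k : Fin n, (binomUpper 0 n)ᵀ i k * binomUpper a n k j
      = if (k : ℕ) ≤ j then
          Ring.choose ((i : ℕ) : ℂ) k * Ring.choose (a + ((j : ℕ) : ℂ)) ((j : ℕ) - k)
        else 0 := by
    intro k
    simp only [transpose_apply, binomUpper, of_apply, zero_add, Fin.le_def, Ring.choose_natCast]
    by_cases hk : (k : ℕ) ≤ i
    · simp [hk, Nat.choose_symm hk]
    · simp [hk, Nat.choose_eq_zero_of_lt (not_le.mp hk)]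
  rw [sum_congr rfl fun k _ => hsum k, Fin.sum_univ_eq_sum_range (fun k => if k ≤ (j : ℕ) then
    Ring.choose ((i : ℕ) : ℂ) k * Ring.choose (a + ((j : ℕ) : ℂ)) ((j : ℕ) - k) else 0),
    ← sum_subset hsub]
  · refine sum_congr rfl fun k hk => if_pos ?_
    simpa [Nat.lt_succ_iff] using hk
  · intro k _ hk
    exact if_neg (by simpa [Nat.lt_succ_iff] using hk)

open Matrix in
theorem bdet_zero_zero_of_odd (μ : ℂ) {n : ℕ} (hn : Odd n) : bdet μ n 0 0 = 0 := by
  set D := signDiag n with hD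
  set L := (binomUpper 0 n)ᵀ with hL
  set U := binomUpper (μ - 2) n with hU
  have hDD : D * D = 1 := by
    simp [hD, signDiag, ← mul_pow]
  have hDt : Dᵀ = D := by simp [hD, signDiag]
  have hU2 : (D * U) * (D * U) = 1 := signDiag_mul_binomUpper_sq _ _
  have hL2 : (L * D) * (L * D) = 1 := by
    have h := congrArg transpose (signDiag_mul_binomUpper_sq 0 n)
    simpa only [transpose_mul, ← hD, ← hL, hDt, transpose_one] using h
  have hd : (L * D).det = (D * U).det := by
    rw [det_mul, det_mul, hL, hU, det_transpose, det_binomUpper, det_binomUpper, mul_comm]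
  have h := det_sub_eq_zero_of_involutions hn _ _ hL2 hU2 hd
  rw [show L * D * (D * U) = L * U by
    rw [Matrix.mul_assoc, ← Matrix.mul_assoc D, hDD, Matrix.one_mul]] at h
  rw [← h, bdet]
  congr 1
  ext i j
  rw [Matrix.sub_apply, binom_matrix_factorization, of_apply, gbinom_eq_choose, one_apply]
  simp only [zero_add, ← Fin.ext_iff]
  rw [show μ - 2 + ((i : ℕ) : ℂ) + ((j : ℕ) : ℂ) = μ + ((i : ℕ) : ℂ) + ((j : ℕ) : ℂ) - 2 by ring]
  split_ifs <;> ring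

open Matrix in
theorem bdet_condensation (μ : ℂ) (m : ℕ) :
    bdet μ (m + 1) 1 1 * bdet μ (m + 1) 0 0 - bdet μ (m + 1) 0 1 * bdet μ (m + 1) 1 0
      = bdet μ (m + 2) 0 0 * bdet μ m 1 1 := by
  have h := desnanot_jacobi (of fun i j : Fin (m + 2) =>
    (if 0 + i.1 = 0 + j.1 then (-1 : ℂ) else 0)
      + gbinom (μ + ((0 + i.1 : ℕ) : ℂ) + ((0 + j.1 : ℕ) : ℂ) - 2) (0 + j.1))
  unfold bdet
  convert h using 1 <;> (congr! 4 <;> (ext i j; simp [add_comm]))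

/-- The even-quotient identity (cleared form):
`b_{2n}(1,1)/b_{2n-2}(1,1) = -(b_{2n}(0,1)/b_{2n-1}(0,1))·(b_{2n}(1,0)/b_{2n-1}(1,0))`. -/
theorem even_quotient_identity (μ : ℂ) (n : ℕ) (hn : 2 ≤ n) :
    bdet μ (2 * n) 1 1 * bdet μ (2 * n - 1) 0 1 * bdet μ (2 * n - 1) 1 0
      = -(bdet μ (2 * n - 2) 1 1 * bdet μ (2 * n) 0 1 * bdet μ (2 * n) 1 0) := by
  obtain ⟨k, rfl⟩ : ∃ k, n = k + 1 := ⟨n - 1, by omega⟩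
  have h1 := bdet_condensation μ (2 * k)
  have h2 := bdet_condensation μ (2 * k + 1)
  rw [bdet_zero_zero_of_odd μ (n := 2 * k + 1) ⟨k, rfl⟩] at h1
  rw [bdet_zero_zero_of_odd μ (n := 2 * k + 1 + 2) ⟨k + 1, by ring⟩] at h2
  rw [show 2 * (k + 1) - 1 = 2 * k + 1 by omega, show 2 * (k + 1) - 2 = 2 * k by omega,
    show 2 * (k + 1) = 2 * k + 2 by ring]
  linear_combination (-bdet μ (2 * k + 2) 1 1) * h1 - bdet μ (2 * k) 1 1 * h2
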